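/- (One-step descent with small stepsize, established in the proof of Theorem 2.) Let H be a real Hilbert space, m ≥ 1, L > 0, and 0 < η ≤ 1/(4L), and let J_1,…,J_m : H → ℝ be Fréchet differentiable with gradients ∇J_i satisfying the L-smoothness inequality J_i(f) ≤ J_i(g) + ⟨f − g, ∇J_i(g)⟩ + (L/2)‖f − g‖² for all f, g ∈ H. Let P be an m×m doubly stochastic matrix, let f_1,…,f_m ∈ H, and set f_i⁺ := Σ_{j=1}^m [P]_{ij}(f_j − η ∇J_j(f_j)), f̄ := (1/m) Σ_{i=1}^m f_i, and f̄⁺ := (1/m) Σ_{i=1}^m f_i⁺. Then, with J := Σ_{i=1}^m J_i and ∇J := Σ_{i=1}^m ∇J_i: J(f̄⁺) ≤ J(f̄) − (η/(4m)) ‖∇J(f̄)‖² + (3η/4) Σ_{i=1}^m ‖∇J_i(f_i) − ∇J_i(f̄)‖². -/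

import Mathlib

open Finset
open scoped RealInnerProductSpace

/-- Summing a vector-valued function after mixing with a column-stochastic matrix
does not change the total. -/
theorem sum_sum_smul_of_col_sum_one {ι E : Type*} [Fintype ι] [AddCommGroup E] [Module ℝ E]
    (P : Matrix ι ι ℝ) (hcol : ∀ j, ∑ i, P i j = 1) (v : ι → E) :
    ∑ i, ∑ j, P i j • v j = ∑ j, v j := by
  rw [Finset.sum_comm]
  simp [← Finset.sum_smul, hcol]

theorem norm_sum_sq_le_card_mul_sum_norm_sq {ι E : Type*} [Fintype ι] [SeminormedAddCommGroup E]
    (v : ι → E) : ‖∑ i, v i‖ ^ 2 ≤ Fintype.card ι * ∑ i, ‖v i‖ ^ 2 :=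
  calc ‖∑ i, v i‖ ^ 2 ≤ (∑ i, ‖v i‖) ^ 2 := by gcongr; exact norm_sum_le _ _
    _ ≤ Fintype.card ι * ∑ i, ‖v i‖ ^ 2 := sq_sum_le_card_mul_sum_sq

theorem neg_inner_add_norm_sq_div_le {E : Type*} [NormedAddCommGroup E] [InnerProductSpace ℝ E]
    (s g : E) : -⟪s, g⟫ + ‖s‖ ^ 2 / 8 ≤ -(‖g‖ ^ 2 / 4) + 3 / 4 * ‖s - g‖ ^ 2 := by
  linarith [norm_sub_sq_real s g, sq_nonneg ‖s - g‖, sq_nonneg ‖s‖, sq_nonneg ‖g‖]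

/-- **One-step descent with small stepsize** (proof of Theorem 2).
In a real Hilbert space `H`, with `L`-smooth Fréchet differentiable `J_i`
(gradients `∇J_i`), `0 < η ≤ 1/(4L)`, a doubly stochastic matrix `P`, points
`f_i`, and `f_i⁺ := Σ_j P i j • (f_j − η ∇J_j(f_j))`, writing `f̄`, `f̄⁺` for the
averages and `J := Σ_i J_i`, `∇J := Σ_i ∇J_i`:
`J(f̄⁺) ≤ J(f̄) − (η/(4m)) ‖∇J(f̄)‖² + (3η/4) Σ_i ‖∇J_i(f_i) − ∇J_i(f̄)‖²`. -/
theorem dfgd_one_step_descent_small_stepsize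
    {H : Type*} [NormedAddCommGroup H] [InnerProductSpace ℝ H] [CompleteSpace H]
    (m : ℕ) (hm : 1 ≤ m) (L η : ℝ) (hL : 0 < L) (hη : 0 < η) (hηL : η ≤ 1 / (4 * L))
    (J : Fin m → H → ℝ) (gJ : Fin m → H → H)
    (hdiff : ∀ (i : Fin m) (f : H), HasGradientAt (J i) (gJ i f) f)
    (hsmooth : ∀ (i : Fin m) (f g : H),
      J i f ≤ J i g + ⟪f - g, gJ i g⟫ + L / 2 * ‖f - g‖ ^ 2)
    (P : Matrix (Fin m) (Fin m) ℝ)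
    (hnn : ∀ i j, 0 ≤ P i j)
    (hrow : ∀ i, ∑ j, P i j = 1)
    (hcol : ∀ j, ∑ i, P i j = 1)
    (f fplus : Fin m → H) (fbar fbarplus : H)
    (hfplus : ∀ i, fplus i = ∑ j, P i j • (f j - η • gJ j (f j)))
    (hfbar : fbar = (m : ℝ)⁻¹ • ∑ i, f i)
    (hfbarplus : fbarplus = (m : ℝ)⁻¹ • ∑ i, fplus i) :
    ∑ i, J i fbarplus ≤
      (∑ i, J i fbar) - η / (4 * m) * ‖∑ i, gJ i fbar‖ ^ 2
        + 3 * η / 4 * ∑ i, ‖gJ i (f i) - gJ i fbar‖ ^ 2 := by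
  have hm' : (0 : ℝ) < m := by exact_mod_cast hm
  set S := ∑ i, gJ i (f i) with hS
  set G := ∑ i, gJ i fbar with hG
  have hstep : fbarplus - fbar = -((η / m) • S) := by
    simp only [hfbarplus, hfplus, sum_sum_smul_of_col_sum_one P hcol, Finset.sum_sub_distrib,
      ← Finset.smul_sum, ← hS, hfbar]
    module
  have hnorm : ‖fbarplus - fbar‖ ^ 2 = (η / m) ^ 2 * ‖S‖ ^ 2 := by
    rw [hstep, norm_neg, norm_smul, mul_pow, Real.norm_eq_abs, sq_abs]
  have hsum : ∑ i, J i fbarplus ≤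
      ∑ i, J i fbar - η / m * ⟪S, G⟫ + m * (L / 2 * ((η / m) ^ 2 * ‖S‖ ^ 2)) := by
    refine (Finset.sum_le_sum fun i _ => hsmooth i fbarplus fbar).trans_eq ?_
    rw [Finset.sum_add_distrib, Finset.sum_add_distrib, ← inner_sum, ← hG, hnorm, hstep,
      inner_neg_left, real_inner_smul_left, Finset.sum_const, Finset.card_univ,
      Fintype.card_fin, nsmul_eq_mul]
    ring
  have hLη : L * η ≤ 1 / 4 := by
    rw [le_div_iff₀ (by positivity)] at hηL
    linarith
  have hquad : m * (L / 2 * ((η / m) ^ 2 * ‖S‖ ^ 2)) ≤ η / m * (‖S‖ ^ 2 / 8) :=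
    calc m * (L / 2 * ((η / m) ^ 2 * ‖S‖ ^ 2)) = L * η * (η / m * (‖S‖ ^ 2 / 2)) := by
          field_simp
      _ ≤ 1 / 4 * (η / m * (‖S‖ ^ 2 / 2)) := by gcongr
      _ = η / m * (‖S‖ ^ 2 / 8) := by ring
  have hcombine := mul_le_mul_of_nonneg_left (neg_inner_add_norm_sq_div_le S G)
    (div_pos hη hm').le
  have herr : η / m * (3 / 4 * ‖S - G‖ ^ 2) ≤
      3 * η / 4 * ∑ i, ‖gJ i (f i) - gJ i fbar‖ ^ 2 :=
    calc η / m * (3 / 4 * ‖S - G‖ ^ 2)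
        ≤ η / m * (3 / 4 * (m * ∑ i, ‖gJ i (f i) - gJ i fbar‖ ^ 2)) := by
          gcongr
          rw [hS, hG, ← Finset.sum_sub_distrib]
          simpa using norm_sum_sq_le_card_mul_sum_norm_sq fun i => gJ i (f i) - gJ i fbar
      _ = 3 * η / 4 * ∑ i, ‖gJ i (f i) - gJ i fbar‖ ^ 2 := by field_simp
  have hcoeff : η / (4 * m) * ‖G‖ ^ 2 = η / m * (‖G‖ ^ 2 / 4) := by field_simp
  linarith
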